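/- arXiv:1906.03898 — 2 statements merged into one kernel-verified Lean document; each statement's English description precedes it below -/
import Mathlib

section
/- Let N ≥ 1 be an integer and for 1 ≤ i ≤ N define F_i(n,m) = Q_{(i−1,N+1−i)}(n,m) + Q_{(i,N−i)}(n,m). Then for every ℓ with 1 ≤ ℓ ≤ N−1 and all (n,m) ∈ ℤ², the unconditional identity u(n,m)·(F_ℓ(n+1,m) + F_{ℓ+1}(n,m+1)) = Q_{(ℓ,N+1−ℓ)}(n,m) + Q_{(ℓ+1,N−ℓ)}(n,m) holds. -/
/-- The lattice-path polynomials `Q_{(i,j)}` built from `u : ℤ × ℤ → R`. -/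
noncomputable def Qp {R : Type*} [CommRing R] (u : ℤ → ℤ → R) : ℕ → ℕ → ℤ → ℤ → R
  | 0, 0, n, m => u n m
  | i+1, 0, n, m => Qp u i 0 n m * u (n + (i+1 : ℕ)) m
  | 0, j+1, n, m => Qp u 0 j n m * u n (m + (j+1 : ℕ))
  | i+1, j+1, n, m => (Qp u (i+1) j n m + Qp u i (j+1) n m) * u (n + (i+1 : ℕ)) (m + (j+1 : ℕ))

/-- `F_i = Q_{(i-1,N+1-i)} + Q_{(i,N-i)}`. -/
noncomputable def Fp {R : Type*} [CommRing R] (u : ℤ → ℤ → R) (N i : ℕ) (n m : ℤ) : R :=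
  Qp u (i - 1) (N + 1 - i) n m + Qp u i (N - i) n m

theorem Qp_succ_zero {R : Type*} [CommRing R] (u : ℤ → ℤ → R) (i : ℕ) (n m : ℤ) :
    Qp u (i + 1) 0 n m = Qp u i 0 n m * u (n + (i + 1 : ℕ)) m := by
  rw [Qp]

theorem Qp_zero_succ {R : Type*} [CommRing R] (u : ℤ → ℤ → R) (j : ℕ) (n m : ℤ) :
    Qp u 0 (j + 1) n m = Qp u 0 j n m * u n (m + (j + 1 : ℕ)) := by
  rw [Qp]

theorem Qp_succ_succ {R : Type*} [CommRing R] (u : ℤ → ℤ → R) (i j : ℕ) (n m : ℤ) :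
    Qp u (i + 1) (j + 1) n m = (Qp u (i + 1) j n m + Qp u i (j + 1) n m) *
      u (n + (i + 1 : ℕ)) (m + (j + 1 : ℕ)) := by
  rw [Qp]

theorem Qp_succ_zero_left {R : Type*} [CommRing R] (u : ℤ → ℤ → R) (i : ℕ) (n m : ℤ) :
    Qp u (i + 1) 0 n m = u n m * Qp u i 0 (n + 1) m := by
  induction i with
  | zero => simp [Qp]
  | succ i ih =>
    rw [Qp, ih, Qp, show n + ((i + 1 + 1 : ℕ) : ℤ) = n + 1 + ((i + 1 : ℕ) : ℤ) by push_cast; ring]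
    ring

theorem Qp_zero_succ_left {R : Type*} [CommRing R] (u : ℤ → ℤ → R) (j : ℕ) (n m : ℤ) :
    Qp u 0 (j + 1) n m = u n m * Qp u 0 j n (m + 1) := by
  induction j with
  | zero => simp [Qp]
  | succ j ih =>
    rw [Qp, ih, Qp, show m + ((j + 1 + 1 : ℕ) : ℤ) = m + 1 + ((j + 1 : ℕ) : ℤ) by push_cast; ring]
    ring

/-- The recursion for `Qp` obtained by splitting off the first step of a path
instead of the last one. -/
theorem Qp_succ_succ_left {R : Type*} [CommRing R] (u : ℤ → ℤ → R) (i j : ℕ) (n m : ℤ) :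
    Qp u (i + 1) (j + 1) n m =
      u n m * (Qp u i (j + 1) (n + 1) m + Qp u (i + 1) j n (m + 1)) := by
  have hn (i : ℕ) : n + ((i + 1 + 1 : ℕ) : ℤ) = n + 1 + ((i + 1 : ℕ) : ℤ) := by push_cast; ring
  have hm (j : ℕ) : m + ((j + 1 + 1 : ℕ) : ℤ) = m + 1 + ((j + 1 : ℕ) : ℤ) := by push_cast; ring
  have hn0 : n + ((0 + 1 : ℕ) : ℤ) = n + 1 := by simp
  have hm0 : m + ((0 + 1 : ℕ) : ℤ) = m + 1 := by simp
  induction i generalizing j with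
  | zero =>
    induction j with
    | zero =>
      rw [Qp_succ_succ, Qp_succ_zero_left, Qp_zero_succ_left, Qp_zero_succ, Qp_succ_zero, hn0, hm0]
      ring
    | succ j ih =>
      rw [Qp_succ_succ, ih, Qp_zero_succ_left u (j + 1) n m, Qp_zero_succ u (j + 1) (n + 1) m,
        Qp_succ_succ u 0 j n (m + 1), hm, hn0]
      ring
  | succ i ih =>
    induction j with
    | zero =>
      rw [Qp_succ_succ, ih, Qp_succ_zero_left, Qp_succ_succ u i 0 (n + 1) m,
        Qp_succ_zero u (i + 1), hn, hm0]
      ring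
    | succ j ihj =>
      rw [Qp_succ_succ, ihj, ih, Qp_succ_succ u i (j + 1) (n + 1) m,
        Qp_succ_succ u (i + 1) j n (m + 1), hn, hm]
      ring

/-- the unconditional identity
`u(n,m)·(F_ℓ(n+1,m) + F_{ℓ+1}(n,m+1)) = Q_{(ℓ,N+1-ℓ)}(n,m) + Q_{(ℓ+1,N-ℓ)}(n,m)`. -/
theorem F_identity {R : Type*} [CommRing R] (u : ℤ → ℤ → R) (N : ℕ) (hN : 1 ≤ N)
    (ℓ : ℕ) (hℓ1 : 1 ≤ ℓ) (hℓ2 : ℓ ≤ N - 1) (n m : ℤ) :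
    u n m * (Fp u N ℓ (n + 1) m + Fp u N (ℓ + 1) n (m + 1)) =
      Qp u ℓ (N + 1 - ℓ) n m + Qp u (ℓ + 1) (N - ℓ) n m := by
  obtain ⟨a, rfl⟩ : ∃ a, ℓ = a + 1 := ⟨ℓ - 1, by omega⟩
  obtain ⟨k, rfl⟩ : ∃ k, N = a + 1 + (k + 1) := ⟨N - (a + 1) - 1, by omega⟩
  have hk₂ : a + 1 + (k + 1) + 1 - (a + 1) = k + 1 + 1 := by omega
  have hk₁ : a + 1 + (k + 1) - (a + 1) = k + 1 := by omega
  have hk₁' : a + 1 + (k + 1) + 1 - (a + 1 + 1) = k + 1 := by omega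
  have hk : a + 1 + (k + 1) - (a + 1 + 1) = k := by omega
  simp only [Fp, hk₂, hk₁, hk₁', hk, Nat.add_sub_cancel]
  rw [Qp_succ_succ_left u a (k + 1), Qp_succ_succ_left u (a + 1) k]
  ring
end

section
/- Let u : ℝ → ℤ × ℤ → ℝ with u(t,n,m) ≠ 0 for all t, n, m, and suppose that for every (n,m) and every t the function t ↦ u(t,n,m) has derivative u(t,n,m)·(u(t,n+3,m)/u(t,n−1,m) + u(t,n+2,m)/u(t,n−2,m) + u(t,n+1,m)/u(t,n−3,m)) at t. Define E₁(t,n,m) = u(t,n,m+3)·(u(t,n,m)−u(t,n+1,m+1))·(u(t,n,m+1)−u(t,n+1,m+2))·(u(t,n,m+2)−u(t,n+1,m+3)) + u(t,n+1,m)·(u(t,n,m+2)·(u(t,n,m)−u(t,n+1,m+1))·(u(t,n,m+1)−u(t,n+1,m+2)) + u(t,n+1,m+3)·(u(t,n,m)·(u(t,n+1,m+2)−u(t,n,m+1)) + u(t,n,m+1)·u(t,n+1,m+1))); E₂(t,n,m) = u(t,n,m+2)·(u(t,n,m)−u(t,n+1,m+1))·(u(t,n,m+1)−u(t,n+1,m+2))·(u(t,n+1,m)−u(t,n+2,m+1))·(u(t,n+1,m+1)−u(t,n+2,m+2))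 + u(t,n+2,m)·(u(t,n,m+1)·u(t,n+1,m+1)·u(t,n+2,m+1)·(u(t,n+1,m+1)−u(t,n,m)) + u(t,n+1,m)·(u(t,n+1,m+1)−u(t,n+2,m+2))·(u(t,n,m)·(u(t,n,m+1)−u(t,n+1,m+2)) − u(t,n,m+1)·u(t,n+1,m+1))); and E₃(t,n,m) = u(t,n,m+1)·(u(t,n,m)−u(t,n+1,m+1))·(u(t,n+1,m)−u(t,n+2,m+1))·(u(t,n+2,m)−u(t,n+3,m+1)) + u(t,n,m)·u(t,n+1,m)·u(t,n+2,m)·u(t,n+3,m). If at some time t₀ one has E₁(t₀,n,m) = E₂(t₀,n,m) = E₃(t₀,n,m) = 0 for all (n,m) ∈ ℤ², then for every (n,m) and every k ∈ {1,2,3} the function t ↦ E_k(t,n,m) has derivative 0 at t₀. (The flow ∂_t u_{0,0} = u_{0,0}(u_{3,0}/u_{−1,0} + u_{2,0}/u_{−2,0} + u_{1,0}/u_{−3,0}) is a generalized symmetry of the consistent system of order three.) -/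
/-- Nowhere vanishing lattice functions satisfying the consistent system of order three. -/
structure IsOrderThreeSolution (u : ℤ → ℤ → ℝ) : Prop where
  ne_zero (n m : ℤ) : u n m ≠ 0
  eq₁ (n m : ℤ) :
    u n (m+3) * (u n m - u (n+1) (m+1)) * (u n (m+1) - u (n+1) (m+2))
        * (u n (m+2) - u (n+1) (m+3))
      + u (n+1) m * (u n (m+2) * (u n m - u (n+1) (m+1)) * (u n (m+1) - u (n+1) (m+2))
        + u (n+1) (m+3) * (u n m * (u (n+1) (m+2) - u n (m+1))
          + u n (m+1) * u (n+1) (m+1))) = 0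
  eq₂ (n m : ℤ) :
    u n (m+2) * (u n m - u (n+1) (m+1)) * (u n (m+1) - u (n+1) (m+2))
        * (u (n+1) m - u (n+2) (m+1)) * (u (n+1) (m+1) - u (n+2) (m+2))
      + u (n+2) m * (u n (m+1) * u (n+1) (m+1) * u (n+2) (m+1) * (u (n+1) (m+1) - u n m)
        + u (n+1) m * (u (n+1) (m+1) - u (n+2) (m+2))
          * (u n m * (u n (m+1) - u (n+1) (m+2)) - u n (m+1) * u (n+1) (m+1))) = 0
  eq₃ (n m : ℤ) :
    u n (m+1) * (u n m - u (n+1) (m+1)) * (u (n+1) m - u (n+2) (m+1))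
        * (u (n+2) m - u (n+3) (m+1))
      + u n m * u (n+1) m * u (n+2) m * u (n+3) m = 0

/-- The variable `1 - u_{1,1} / u_{0,0}`, which satisfies a modified Bogoyavlensky lattice. -/
noncomputable def latticeSlope (u : ℤ → ℤ → ℝ) (n m : ℤ) : ℝ := 1 - u (n+1) (m+1) / u n m

/-- The variable `u_{4,0} / u_{0,0}`, which satisfies the Bogoyavlensky lattice. -/
noncomputable def latticeRatio (u : ℤ → ℤ → ℝ) (n m : ℤ) : ℝ := u (n+4) m / u n m

/-- The logarithmic derivative of `u` along the flow. -/
noncomputable def flowRate (u : ℤ → ℤ → ℝ) (n m : ℤ) : ℝ :=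
  latticeRatio u (n-1) m + latticeRatio u (n-2) m + latticeRatio u (n-3) m

/-- The logarithmic derivative of `latticeSlope u` along the flow. -/
noncomputable def slopeRate (u : ℤ → ℤ → ℝ) (n m : ℤ) : ℝ :=
  latticeRatio u n m - latticeRatio u (n-3) (m+1)

/-- The polynomial in two consecutive slopes on two consecutive rows governing the second
equation of the system. -/
def slopeQuad (y₀ y₁ z₀ z₁ : ℝ) : ℝ := z₀ * z₁ + y₀ * y₁ + y₀ * z₁ - y₀ - z₁

/-- The polynomial in the slopes on three consecutive rows governing the first equation of the
system. -/
def slopeTriple (y z x : ℝ) : ℝ := y * z + (1 - x) * (1 - y - z)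

theorem diag_eq_mul_slope {u : ℤ → ℤ → ℝ} {n m : ℤ} (h : u n m ≠ 0) :
    u (n+1) (m+1) = u n m * (1 - latticeSlope u n m) := by
  unfold latticeSlope
  field_simp
  ring

theorem eq₁_lhs_eq {u : ℤ → ℤ → ℝ} (h : ∀ n m, u n m ≠ 0) (n m : ℤ) :
    u n (m+3) * (u n m - u (n+1) (m+1)) * (u n (m+1) - u (n+1) (m+2))
        * (u n (m+2) - u (n+1) (m+3))
      + u (n+1) m * (u n (m+2) * (u n m - u (n+1) (m+1)) * (u n (m+1) - u (n+1) (m+2))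
        + u (n+1) (m+3) * (u n m * (u (n+1) (m+2) - u n (m+1))
          + u n (m+1) * u (n+1) (m+1))) =
    u n m * u n (m+1) * u n (m+2) *
      (u n (m+3) * (latticeSlope u n m * latticeSlope u n (m+1) * latticeSlope u n (m+2))
        + u (n+1) m *
          slopeTriple (latticeSlope u n m) (latticeSlope u n (m+1)) (latticeSlope u n (m+2))) := by
  have h0 := diag_eq_mul_slope (h n m)
  have h1 := diag_eq_mul_slope (h n (m+1))
  have h2 := diag_eq_mul_slope (h n (m+2))
  simp only [add_assoc, Int.reduceAdd] at h1 h2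
  rw [h0, h1, h2, slopeTriple]
  ring

theorem eq₂_lhs_eq {u : ℤ → ℤ → ℝ} (h : ∀ n m, u n m ≠ 0) (n m : ℤ) :
    u n (m+2) * (u n m - u (n+1) (m+1)) * (u n (m+1) - u (n+1) (m+2))
        * (u (n+1) m - u (n+2) (m+1)) * (u (n+1) (m+1) - u (n+2) (m+2))
      + u (n+2) m * (u n (m+1) * u (n+1) (m+1) * u (n+2) (m+1) * (u (n+1) (m+1) - u n m)
        + u (n+1) m * (u (n+1) (m+1) - u (n+2) (m+2))
          * (u n m * (u n (m+1) - u (n+1) (m+2)) - u n (m+1) * u (n+1) (m+1))) =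
    u n m * u (n+1) m * u n (m+1) * u (n+1) (m+1) *
      (u n (m+2) * (latticeSlope u n m * latticeSlope u (n+1) m
          * latticeSlope u n (m+1) * latticeSlope u (n+1) (m+1))
        + u (n+2) m * slopeQuad (latticeSlope u n m) (latticeSlope u (n+1) m)
          (latticeSlope u n (m+1)) (latticeSlope u (n+1) (m+1))) := by
  have h0 := diag_eq_mul_slope (h n m)
  have h1 := diag_eq_mul_slope (h (n+1) m)
  have h2 := diag_eq_mul_slope (h n (m+1))
  have h3 := diag_eq_mul_slope (h (n+1) (m+1))
  simp only [add_assoc, Int.reduceAdd] at h1 h2 h3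
  rw [h3, h2, h1, h0, slopeQuad]
  ring

theorem eq₃_lhs_eq {u : ℤ → ℤ → ℝ} (h : ∀ n m, u n m ≠ 0) (n m : ℤ) :
    u n (m+1) * (u n m - u (n+1) (m+1)) * (u (n+1) m - u (n+2) (m+1))
        * (u (n+2) m - u (n+3) (m+1))
      + u n m * u (n+1) m * u (n+2) m * u (n+3) m =
    u n m * u (n+1) m * u (n+2) m *
      (u n (m+1) * (latticeSlope u n m * latticeSlope u (n+1) m * latticeSlope u (n+2) m)
        + u (n+3) m) := by
  have h0 := diag_eq_mul_slope (h n m)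
  have h1 := diag_eq_mul_slope (h (n+1) m)
  have h2 := diag_eq_mul_slope (h (n+2) m)
  simp only [add_assoc, Int.reduceAdd] at h1 h2
  rw [h2, h1, h0]
  ring

namespace IsOrderThreeSolution

variable {u : ℤ → ℤ → ℝ}

theorem slope_eq₁ (h : IsOrderThreeSolution u) (n m : ℤ) :
    u n (m+3) * (latticeSlope u n m * latticeSlope u n (m+1) * latticeSlope u n (m+2))
      + u (n+1) m *
        slopeTriple (latticeSlope u n m) (latticeSlope u n (m+1)) (latticeSlope u n (m+2)) = 0 := by
  have := h.eq₁ n m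
  rw [eq₁_lhs_eq h.ne_zero] at this
  simpa [h.ne_zero] using this

theorem slope_eq₂ (h : IsOrderThreeSolution u) (n m : ℤ) :
    u n (m+2) * (latticeSlope u n m * latticeSlope u (n+1) m
        * latticeSlope u n (m+1) * latticeSlope u (n+1) (m+1))
      + u (n+2) m * slopeQuad (latticeSlope u n m) (latticeSlope u (n+1) m)
        (latticeSlope u n (m+1)) (latticeSlope u (n+1) (m+1)) = 0 := by
  have := h.eq₂ n m
  rw [eq₂_lhs_eq h.ne_zero] at this
  simpa [h.ne_zero] using this

theorem slope_eq₃ (h : IsOrderThreeSolution u) (n m : ℤ) :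
    u n (m+1) * (latticeSlope u n m * latticeSlope u (n+1) m * latticeSlope u (n+2) m)
      + u (n+3) m = 0 := by
  have := h.eq₃ n m
  rw [eq₃_lhs_eq h.ne_zero] at this
  simpa [h.ne_zero] using this

theorem slope_ne_zero (h : IsOrderThreeSolution u) (n m : ℤ) : latticeSlope u n m ≠ 0 := by
  intro h0
  have := h.slope_eq₃ n m
  simp [h0, h.ne_zero] at this

theorem ratio_eq (h : IsOrderThreeSolution u) (n m : ℤ) :
    latticeRatio u n m = (latticeSlope u n m - 1) * latticeSlope u (n+1) m
      * latticeSlope u (n+2) m * latticeSlope u (n+3) m := by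
  have h0 := diag_eq_mul_slope (h.ne_zero n m)
  have h1 := h.slope_eq₃ (n+1) m
  simp only [add_assoc, Int.reduceAdd] at h1
  rw [latticeRatio, div_eq_iff (h.ne_zero n m)]
  rw [h0] at h1
  linear_combination h1

theorem ratio_succ_eq (h : IsOrderThreeSolution u) (n m : ℤ) :
    latticeRatio u n (m+1) = (latticeSlope u (n+3) m - 1) * latticeSlope u n m
      * latticeSlope u (n+1) m * latticeSlope u (n+2) m := by
  have h0 := diag_eq_mul_slope (h.ne_zero (n+3) m)
  have h1 := h.slope_eq₃ n m
  simp only [add_assoc, Int.reduceAdd] at h0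
  rw [latticeRatio, div_eq_iff (h.ne_zero n (m+1)), h0]
  linear_combination (1 - latticeSlope u (n+3) m) * h1

/-- The second equation of the system in terms of slopes only. -/
theorem slope_cubic (h : IsOrderThreeSolution u) (n m : ℤ) :
    latticeSlope u (n+2) (m+1) * slopeQuad (latticeSlope u n m) (latticeSlope u (n+1) m)
        (latticeSlope u n (m+1)) (latticeSlope u (n+1) (m+1)) =
      latticeSlope u n m * latticeSlope u (n+1) m * (1 - latticeSlope u (n+2) m) := by
  have h0 := diag_eq_mul_slope (h.ne_zero (n+2) m)
  have h2 := h.slope_eq₂ n m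
  have h3 := h.slope_eq₃ n (m+1)
  simp only [add_assoc, Int.reduceAdd] at h0 h3
  rw [h0] at h3
  apply mul_left_cancel₀ (h.ne_zero (n+2) m)
  linear_combination latticeSlope u (n+2) (m+1) * h2
    - latticeSlope u n m * latticeSlope u (n+1) m * h3

/-- A mirrored form of `slope_cubic`. -/
theorem slope_cubic_mirror (h : IsOrderThreeSolution u) (n m : ℤ) :
    latticeSlope u n m * slopeQuad (latticeSlope u (n+1) m) (latticeSlope u (n+2) m)
        (latticeSlope u (n+1) (m+1)) (latticeSlope u (n+2) (m+1)) =
      latticeSlope u (n+1) (m+1) * latticeSlope u (n+2) (m+1) * (1 - latticeSlope u n (m+1)) := by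
  have h0 := h.slope_cubic n m
  simp only [slopeQuad] at h0 ⊢
  linear_combination h0

theorem slopeTriple_left (h : IsOrderThreeSolution u) (n m : ℤ) :
    latticeSlope u (n+1) (m+1) * latticeSlope u (n+1) (m+2) *
        slopeTriple (latticeSlope u n m) (latticeSlope u n (m+1)) (latticeSlope u n (m+2)) =
      latticeSlope u n m * (1 - latticeSlope u (n+1) m) *
        slopeQuad (latticeSlope u n (m+1)) (latticeSlope u (n+1) (m+1))
          (latticeSlope u n (m+2)) (latticeSlope u (n+1) (m+2)) := by
  have h0 := diag_eq_mul_slope (h.ne_zero (n+1) m)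
  have h1 := h.slope_eq₁ n m
  have h2 := h.slope_eq₂ n (m+1)
  simp only [add_assoc, Int.reduceAdd] at h0 h2
  rw [h0] at h2
  apply mul_left_cancel₀ (h.ne_zero (n+1) m)
  linear_combination latticeSlope u (n+1) (m+1) * latticeSlope u (n+1) (m+2) * h1
    - latticeSlope u n m * h2

theorem slopeTriple_right (h : IsOrderThreeSolution u) (n m : ℤ) :
    latticeSlope u n m * latticeSlope u n (m+1) * slopeTriple (latticeSlope u (n+1) m)
        (latticeSlope u (n+1) (m+1)) (latticeSlope u (n+1) (m+2)) =
      (1 - latticeSlope u n (m+2)) * latticeSlope u (n+1) (m+2) *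
        slopeQuad (latticeSlope u n m) (latticeSlope u (n+1) m)
          (latticeSlope u n (m+1)) (latticeSlope u (n+1) (m+1)) := by
  have h0 := diag_eq_mul_slope (h.ne_zero n (m+2))
  have h1 := h.slope_eq₁ (n+1) m
  have h2 := h.slope_eq₂ n m
  simp only [add_assoc, Int.reduceAdd] at h0 h1
  rw [h0] at h1
  apply mul_left_cancel₀ (h.ne_zero (n+2) m)
  linear_combination latticeSlope u n m * latticeSlope u n (m+1) * h1
    - (1 - latticeSlope u n (m+2)) * latticeSlope u (n+1) (m+2) * h2

/-- The rates of `u` at the two ends of a diagonal differ by the rate of `1 - latticeSlope u`. -/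
theorem flowRate_diag (h : IsOrderThreeSolution u) (n m : ℤ) :
    (1 - latticeSlope u n m) * (flowRate u (n+1) (m+1) - flowRate u n m) =
      -(latticeSlope u n m * slopeRate u n m) := by
  obtain ⟨n, rfl⟩ : ∃ k, n = k + 3 := ⟨n - 3, by ring⟩
  have w0 := h.ratio_eq n m
  have w1 := h.ratio_eq (n+1) m
  have w2 := h.ratio_eq (n+2) m
  have w3 := h.ratio_eq (n+3) m
  have v0 := h.ratio_succ_eq n m
  have v1 := h.ratio_succ_eq (n+1) m
  have v2 := h.ratio_succ_eq (n+2) m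
  have v3 := h.ratio_succ_eq (n+3) m
  simp only [flowRate, slopeRate, add_assoc, add_sub_assoc, Int.reduceAdd, Int.reduceSub,
    add_zero] at *
  rw [w0, w1, w2, w3, v0, v1, v2, v3]
  ring

end IsOrderThreeSolution

/-- The rates in the third equation of the system balance identically. -/
theorem flowRate_add_slopeRate (u : ℤ → ℤ → ℝ) (n m : ℤ) :
    flowRate u n (m+1) + slopeRate u n m + slopeRate u (n+1) m + slopeRate u (n+2) m =
      flowRate u (n+3) m := by
  simp only [flowRate, slopeRate, add_sub_assoc, Int.reduceSub, add_zero, ← sub_eq_add_neg]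
  ring

/-- The part of the derivative of `slope_cubic` that involves larger shifts. -/
theorem cubic_forward {y₀ y₁ y₂ z₀ z₁ z₂ : ℝ} (y₃ y₄ y₅ : ℝ)
    (h : z₂ * slopeQuad y₀ y₁ z₀ z₁ = y₀ * y₁ * (1 - y₂)) :
    z₁ * z₂ * (1 - z₀) * ((y₀ - 1) * y₁ * y₂ * y₃)
      + y₀ * y₁ * (y₂ + z₂ - 1) * ((y₁ - 1) * y₂ * y₃ * y₄)
      + y₀ * y₁ * y₂ * ((y₂ - 1) * y₃ * y₄ * y₅)
      + y₀ * y₁ * (1 - y₂) * ((y₅ - 1) * y₂ * y₃ * y₄)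
      + z₁ * z₂ * (y₀ + z₀ - 1) * ((y₄ - 1) * y₁ * y₂ * y₃)
      + z₀ * z₁ * z₂ * ((y₃ - 1) * y₀ * y₁ * y₂) = -(y₀ * y₁ * y₂ * z₀ * z₁ * z₂) := by
  rw [slopeQuad] at h
  linear_combination y₁ * y₂ * y₃ * y₄ * h

/-- The part of the derivative of `slope_eq₁` that involves larger shifts. -/
theorem triple_forward {y₀ y₁ y₂ y₃ z₀ z₁ z₂ z₃ : ℝ} (x₀ : ℝ)
    (h : (y₃ - 1) * y₀ * y₁ * y₂ = (z₀ - 1) * z₁ * z₂ * z₃) :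
    y₀ * (x₀ + z₀ - 1) * ((y₀ - 1) * y₁ * y₂ * y₃)
      - (1 - x₀) * (1 - y₀) * ((y₃ - 1) * y₀ * y₁ * y₂)
      - (1 - y₀) * (1 - z₀) * ((z₃ - 1) * z₀ * z₁ * z₂) =
    (1 - y₀) * (z₀ * (1 - z₀) * z₁ * z₂ + y₀ * y₁ * y₂ * (1 - x₀ - z₀)) := by
  linear_combination -(1 - y₀) * z₀ * h

/-- The coefficient of `z₂` in the first equation of the system differentiated along the flow
vanishes; the primed variables carry the shift `-1`. -/
theorem triple_coeff {y₀ y₁ z₀ z₁ x₀ y' z' x' : ℝ} (hy : y' ≠ 0)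
    (hm : y' * slopeQuad y₀ y₁ z₀ z₁ = z₀ * z₁ * (1 - z'))
    (hc : z₁ * slopeQuad y' y₀ z' z₀ = y' * y₀ * (1 - y₁))
    (ht : y' * z' * slopeTriple y₀ z₀ x₀ = (1 - x') * x₀ * slopeQuad y' y₀ z' z₀) :
    (1 - y₀) * z₀ * (1 - z₀) * z₁
      - (slopeTriple y₀ z₀ x₀ * y' - x₀ * z₀) * slopeQuad y₀ y₁ z₀ z₁
      + x₀ * x' * y₀ * (1 - y₁) * z₀ = 0 := by
  apply mul_left_cancel₀ hy
  simp only [slopeQuad, slopeTriple] at *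
  linear_combination -((y₀ * z₀ + (1 - x₀) * (1 - y₀ - z₀)) * y' - x₀ * z₀) * hm
    + z₀ * z₁ * ht - x' * x₀ * z₀ * hc

namespace IsOrderThreeSolution

variable {u : ℤ → ℤ → ℝ}

/-- The second equation of the system is preserved by the flow, in terms of slopes. -/
theorem slopeQuad_rate (h : IsOrderThreeSolution u) (n m : ℤ) :
    latticeSlope u n (m+1) * latticeSlope u (n+1) (m+1)
        * (slopeRate u n (m+1) + slopeRate u (n+1) (m+1))
      + latticeSlope u n m * latticeSlope u (n+1) m * (slopeRate u n m + slopeRate u (n+1) m)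
      + latticeSlope u n m * latticeSlope u (n+1) (m+1)
        * (slopeRate u n m + slopeRate u (n+1) (m+1))
      - latticeSlope u n m * slopeRate u n m
      - latticeSlope u (n+1) (m+1) * slopeRate u (n+1) (m+1) =
    slopeQuad (latticeSlope u n m) (latticeSlope u (n+1) m)
        (latticeSlope u n (m+1)) (latticeSlope u (n+1) (m+1)) *
      (flowRate u n (m+2) + slopeRate u n m + slopeRate u (n+1) m
        + slopeRate u n (m+1) + slopeRate u (n+1) (m+1) - flowRate u (n+2) m) := by
  have hdiag := h.flowRate_diag (n+2) m
  have htel := flowRate_add_slopeRate u n (m+1)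
  have hR := h.slope_cubic n m
  have hz := h.slope_ne_zero (n+2) (m+1)
  obtain ⟨n, rfl⟩ : ∃ k, n = k + 3 := ⟨n - 3, by ring⟩
  have w0 := h.ratio_eq (n+3) m
  have w1 := h.ratio_eq (n+4) m
  have w2 := h.ratio_eq (n+5) m
  have v0 := h.ratio_succ_eq (n+3) m
  have v1 := h.ratio_succ_eq (n+4) m
  have v2 := h.ratio_succ_eq (n+5) m
  have v0' := h.ratio_eq n (m+1)
  have v1' := h.ratio_eq (n+1) (m+1)
  have v2' := h.ratio_eq (n+2) (m+1)
  have s0 := h.ratio_succ_eq n (m+1)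
  have s1 := h.ratio_succ_eq (n+1) (m+1)
  have s2 := h.ratio_succ_eq (n+2) (m+1)
  simp only [slopeRate, add_assoc, add_sub_assoc, Int.reduceAdd, Int.reduceSub,
    add_zero] at *
  have hF := cubic_forward (latticeSlope u (n+6) m) (latticeSlope u (n+7) m)
    (latticeSlope u (n+8) m) hR
  have hB := cubic_forward (y₀ := latticeSlope u (n+5) (m+1)) (y₁ := latticeSlope u (n+4) (m+1))
    (y₂ := latticeSlope u (n+3) (m+1)) (z₀ := latticeSlope u (n+5) m)
    (z₁ := latticeSlope u (n+4) m) (z₂ := latticeSlope u (n+3) m) (latticeSlope u (n+2) (m+1))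
    (latticeSlope u (n+1) (m+1)) (latticeSlope u n (m+1))
    (by rw [slopeQuad] at hR ⊢; linear_combination hR)
  apply mul_left_cancel₀ hz
  simp only [w0, w1, w2, v0, v1, v2, v0', v1', v2', s0, s1, s2] at hdiag htel ⊢
  clear w0 w1 w2 v0 v1 v2 v0' v1' v2' s0 s1 s2 hz
  generalize latticeSlope u (n+3) m = y₀ at *
  generalize latticeSlope u (n+4) m = y₁ at *
  generalize latticeSlope u (n+5) m = y₂ at *
  generalize latticeSlope u (n+6) m = y₃ at *
  generalize latticeSlope u (n+7) m = y₄ at *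
  generalize latticeSlope u n (m+1) = z_c at *
  generalize latticeSlope u (n+1) (m+1) = z_b at *
  generalize latticeSlope u (n+2) (m+1) = z_a at *
  generalize latticeSlope u (n+3) (m+1) = z₀ at *
  generalize latticeSlope u (n+4) (m+1) = z₁ at *
  generalize latticeSlope u (n+5) (m+1) = z₂ at *
  simp only [slopeQuad] at *
  linear_combination hF - hB
    + ((y₀ - 1) * y₁ * y₂ * y₃ - (z_c - 1) * z_b * z_a * z₀
      + (latticeSlope u (n+8) m - 1) * y₂ * y₃ * y₄ - (z₂ - 1) * z_a * z₀ * z₁) * hR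
    - ((y₀ - 1) * y₁ * y₂ * y₃ - (z_c - 1) * z_b * z_a * z₀
      + (y₁ - 1) * y₂ * y₃ * y₄ - (z_b - 1) * z_a * z₀ * z₁) * hR
    - (flowRate u (n+6) (m+1) - flowRate u (n+5) m) * hR
    - y₀ * y₁ * hdiag
    - z₂ * (z₀ * z₁ + y₀ * y₁ + y₀ * z₁ - y₀ - z₁) * htel

/-- The first equation of the system is preserved by the flow, in terms of slopes. -/
theorem slopeTriple_rate (h : IsOrderThreeSolution u) (n m : ℤ) :
    latticeSlope u n m * slopeRate u n m
        * (latticeSlope u n (m+2) + latticeSlope u n (m+1) - 1)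
      + latticeSlope u n (m+1) * slopeRate u n (m+1)
        * (latticeSlope u n (m+2) + latticeSlope u n m - 1)
      + latticeSlope u n (m+2) * slopeRate u n (m+2)
        * (latticeSlope u n m + latticeSlope u n (m+1) - 1) =
    slopeTriple (latticeSlope u n m) (latticeSlope u n (m+1)) (latticeSlope u n (m+2)) *
      (flowRate u n (m+3) + slopeRate u n m + slopeRate u n (m+1) + slopeRate u n (m+2)
        - flowRate u (n+1) m) := by
  obtain ⟨n, rfl⟩ : ∃ k, n = k + 3 := ⟨n - 3, by ring⟩
  have yne := h.slope_ne_zero (n+2) m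
  have xne := h.slope_ne_zero (n+4) (m+2)
  have zne := h.slope_ne_zero (n+2) (m+1)
  have zne' := h.slope_ne_zero (n+4) (m+1)
  have wm2 := h.ratio_eq (n+1) m
  have wm1 := h.ratio_eq (n+2) m
  have w0 := h.ratio_eq (n+3) m
  have v0 := h.ratio_succ_eq (n+3) m
  have v0' := h.ratio_eq (n+3) (m+1)
  have s0 := h.ratio_succ_eq (n+3) (m+1)
  have vm3 := h.ratio_eq n (m+1)
  have sm3 := h.ratio_eq n (m+2)
  have sm3' := h.ratio_succ_eq n (m+1)
  have rm3 := h.ratio_succ_eq n (m+2)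
  have rm2 := h.ratio_succ_eq (n+1) (m+2)
  have rm1 := h.ratio_succ_eq (n+2) (m+2)
  have cyz0 := h.slope_cubic (n+3) m
  have cyzm1 := h.slope_cubic (n+2) m
  have myzm1 := h.slope_cubic_mirror (n+2) m
  have myzm2 := h.slope_cubic_mirror (n+1) m
  have czx0 := h.slope_cubic (n+3) (m+1)
  have czxm1 := h.slope_cubic (n+2) (m+1)
  have mzxm1 := h.slope_cubic_mirror (n+2) (m+1)
  have mzxm2 := h.slope_cubic_mirror (n+1) (m+1)
  have tl := h.slopeTriple_left (n+3) m
  have tr := h.slopeTriple_right (n+2) m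
  simp only [flowRate, slopeRate, add_assoc, add_sub_assoc, Int.reduceAdd, Int.reduceSub,
    add_zero] at *
  have hF := triple_forward (latticeSlope u (n+3) (m+2)) (v0.symm.trans v0')
  have hB := triple_forward (y₀ := latticeSlope u (n+3) (m+2))
    (y₁ := latticeSlope u (n+2) (m+2)) (y₂ := latticeSlope u (n+1) (m+2))
    (y₃ := latticeSlope u n (m+2)) (z₀ := latticeSlope u (n+3) (m+1))
    (z₁ := latticeSlope u (n+2) (m+1)) (z₂ := latticeSlope u (n+1) (m+1))
    (z₃ := latticeSlope u n (m+1)) (latticeSlope u (n+3) m)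
    (by linear_combination sm3.symm.trans sm3')
  have hcF := triple_coeff yne myzm1 cyzm1 tr
  have hcB := triple_coeff (y₀ := latticeSlope u (n+3) (m+2))
    (y₁ := latticeSlope u (n+2) (m+2)) (z₀ := latticeSlope u (n+3) (m+1))
    (z₁ := latticeSlope u (n+2) (m+1)) (x₀ := latticeSlope u (n+3) m)
    (z' := latticeSlope u (n+4) (m+1)) (x' := latticeSlope u (n+4) m) xne
    (by simp only [slopeQuad] at *; linear_combination czxm1)
    (by simp only [slopeQuad] at *; linear_combination mzxm1)
    (by simp only [slopeQuad, slopeTriple] at *; linear_combination tl)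
  have hx := mul_left_cancel₀ zne' (b := slopeTriple (latticeSlope u (n+3) m)
      (latticeSlope u (n+3) (m+1)) (latticeSlope u (n+3) (m+2))
      * latticeSlope u (n+4) (m+2) * latticeSlope u (n+5) (m+2))
    (c := latticeSlope u (n+3) m * (1 - latticeSlope u (n+4) m)
      * latticeSlope u (n+3) (m+1) * (1 - latticeSlope u (n+5) (m+1)))
    (by linear_combination latticeSlope u (n+5) (m+2) * tl
      + latticeSlope u (n+3) m * (1 - latticeSlope u (n+4) m) * czx0)
  have hy := mul_left_cancel₀ zne (b := slopeTriple (latticeSlope u (n+3) m)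
      (latticeSlope u (n+3) (m+1)) (latticeSlope u (n+3) (m+2))
      * latticeSlope u (n+2) m * latticeSlope u (n+1) m)
    (c := latticeSlope u (n+3) (m+2) * (1 - latticeSlope u (n+2) (m+2))
      * latticeSlope u (n+3) (m+1) * (1 - latticeSlope u (n+1) (m+1)))
    (by linear_combination latticeSlope u (n+1) m * tr
      + latticeSlope u (n+3) (m+2) * (1 - latticeSlope u (n+2) (m+2)) * myzm2)
  simp only [wm2, wm1, w0, v0, s0, vm3, sm3, rm3, rm2, rm1]
  simp only [slopeQuad, slopeTriple] at *
  clear wm2 wm1 w0 v0 v0' s0 vm3 sm3 sm3' rm3 rm2 rm1 yne xne zne zne' cyzm1 myzm1 myzm2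
    czx0 czxm1 mzxm1 tl tr
  generalize latticeSlope u (n+1) m = y_b at *
  generalize latticeSlope u (n+2) m = y_a at *
  generalize latticeSlope u (n+3) m = y₀ at *
  generalize latticeSlope u (n+4) m = y₁ at *
  generalize latticeSlope u (n+5) m = y₂ at *
  generalize latticeSlope u (n+1) (m+1) = z_b at *
  generalize latticeSlope u (n+2) (m+1) = z_a at *
  generalize latticeSlope u (n+3) (m+1) = z₀ at *
  generalize latticeSlope u (n+4) (m+1) = z₁ at *
  generalize latticeSlope u (n+5) (m+1) = z₂ at *
  generalize latticeSlope u (n+1) (m+2) = x_b at *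
  generalize latticeSlope u (n+2) (m+2) = x_a at *
  generalize latticeSlope u (n+3) (m+2) = x₀ at *
  generalize latticeSlope u (n+4) (m+2) = x₁ at *
  generalize latticeSlope u (n+5) (m+2) = x₂ at *
  linear_combination hF - hB
    + ((y₀ * z₀ + (1 - x₀) * (1 - y₀ - z₀)) * y_a - x₀ * z₀) * cyz0 + z₂ * hcF + y₀ * y₁ * hy
    - ((y₀ * z₀ + (1 - x₀) * (1 - y₀ - z₀)) * x₁ - y₀ * z₀) * mzxm2 - z_b * hcB
    - x₀ * x_a * hx

end IsOrderThreeSolution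

/-- Along the flow a slope satisfies the modified Bogoyavlensky lattice. -/
theorem hasDerivAt_latticeSlope {u : ℝ → ℤ → ℤ → ℝ} {t : ℝ} (h : IsOrderThreeSolution (u t))
    (hd : ∀ n m, HasDerivAt (fun s => u s n m) (u t n m * flowRate (u t) n m) t) (n m : ℤ) :
    HasDerivAt (fun s => latticeSlope (u s) n m)
      (latticeSlope (u t) n m * slopeRate (u t) n m) t := by
  have hdiag := h.flowRate_diag n m
  have h0 := diag_eq_mul_slope (h.ne_zero n m)
  have hu := h.ne_zero n m
  refine (((hd (n+1) (m+1)).fun_div (hd n m) hu).const_sub 1).congr_deriv ?_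
  rw [h0]
  field_simp
  linear_combination -hdiag

/-- A product is stationary where its second factor vanishes and is stationary. -/
theorem HasDerivAt.mul_of_eq_zero {f g : ℝ → ℝ} {f' t : ℝ} (hf : HasDerivAt f f' t)
    (hg : HasDerivAt g 0 t) (h : g t = 0) : HasDerivAt (fun s => f s * g s) 0 t := by
  simpa [h] using hf.fun_mul hg

/-- the flow
`∂_t u_{0,0} = u_{0,0}(u_{3,0}/u_{-1,0} + u_{2,0}/u_{-2,0} + u_{1,0}/u_{-3,0})`
is a generalized symmetry of the consistent system of order three (3.6). -/
theorem symmetry_order3_system (u : ℝ → ℤ → ℤ → ℝ)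
    (hu : ∀ (t : ℝ) (n m : ℤ), u t n m ≠ 0)
    (hflow : ∀ (n m : ℤ) (t : ℝ),
      HasDerivAt (fun s => u s n m)
        (u t n m * (u t (n+3) m / u t (n-1) m + u t (n+2) m / u t (n-2) m
          + u t (n+1) m / u t (n-3) m)) t)
    (E₁ E₂ E₃ : ℝ → ℤ → ℤ → ℝ)
    (hE₁ : ∀ (t : ℝ) (n m : ℤ),
      E₁ t n m = u t n (m+3) * (u t n m - u t (n+1) (m+1)) * (u t n (m+1) - u t (n+1) (m+2))
          * (u t n (m+2) - u t (n+1) (m+3))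
        + u t (n+1) m * (u t n (m+2) * (u t n m - u t (n+1) (m+1))
            * (u t n (m+1) - u t (n+1) (m+2))
          + u t (n+1) (m+3) * (u t n m * (u t (n+1) (m+2) - u t n (m+1))
            + u t n (m+1) * u t (n+1) (m+1))))
    (hE₂ : ∀ (t : ℝ) (n m : ℤ),
      E₂ t n m = u t n (m+2) * (u t n m - u t (n+1) (m+1)) * (u t n (m+1) - u t (n+1) (m+2))
          * (u t (n+1) m - u t (n+2) (m+1)) * (u t (n+1) (m+1) - u t (n+2) (m+2))
        + u t (n+2) m * (u t n (m+1) * u t (n+1) (m+1) * u t (n+2) (m+1)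
            * (u t (n+1) (m+1) - u t n m)
          + u t (n+1) m * (u t (n+1) (m+1) - u t (n+2) (m+2))
            * (u t n m * (u t n (m+1) - u t (n+1) (m+2)) - u t n (m+1) * u t (n+1) (m+1))))
    (hE₃ : ∀ (t : ℝ) (n m : ℤ),
      E₃ t n m = u t n (m+1) * (u t n m - u t (n+1) (m+1)) * (u t (n+1) m - u t (n+2) (m+1))
          * (u t (n+2) m - u t (n+3) (m+1))
        + u t n m * u t (n+1) m * u t (n+2) m * u t (n+3) m)
    (t₀ : ℝ)
    (hsol : ∀ n m : ℤ, E₁ t₀ n m = 0 ∧ E₂ t₀ n m = 0 ∧ E₃ t₀ n m = 0) :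
    ∀ n m : ℤ,
      HasDerivAt (fun s => E₁ s n m) 0 t₀ ∧
      HasDerivAt (fun s => E₂ s n m) 0 t₀ ∧
      HasDerivAt (fun s => E₃ s n m) 0 t₀ := by
  intro n m
  have hsolution : IsOrderThreeSolution (u t₀) :=
    { ne_zero := hu t₀
      eq₁ := fun n m => (hE₁ t₀ n m).symm.trans (hsol n m).1
      eq₂ := fun n m => (hE₂ t₀ n m).symm.trans (hsol n m).2.1
      eq₃ := fun n m => (hE₃ t₀ n m).symm.trans (hsol n m).2.2 }
  have hd : ∀ n m, HasDerivAt (fun s => u s n m) (u t₀ n m * flowRate (u t₀) n m) t₀ := by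
    intro n m
    convert hflow n m t₀ using 2
    simp only [flowRate, latticeRatio, sub_add]
    norm_num
  have hs := hasDerivAt_latticeSlope hsolution hd
  refine ⟨?_, ?_, ?_⟩
  · simp only [hE₁, eq₁_lhs_eq (hu _)]
    refine (((hd _ _).fun_mul (hd _ _)).fun_mul (hd _ _)).mul_of_eq_zero ?_
      (hsolution.slope_eq₁ n m)
    unfold slopeTriple
    refine (((hd n (m+3)).fun_mul (((hs n m).fun_mul (hs n (m+1))).fun_mul
      (hs n (m+2)))).fun_add ((hd (n+1) m).fun_mul (((hs n m).fun_mul (hs n (m+1))).fun_add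
        (((hs n (m+2)).const_sub 1).fun_mul (((hs n m).const_sub 1).fun_sub (hs n (m+1))))))).congr_deriv ?_
    have h1 := hsolution.slope_eq₁ n m
    have h2 := hsolution.slopeTriple_rate n m
    simp only [slopeTriple] at h1 h2
    linear_combination (flowRate (u t₀) n (m+3) + slopeRate (u t₀) n m + slopeRate (u t₀) n (m+1)
      + slopeRate (u t₀) n (m+2)) * h1 + u t₀ (n+1) m * h2
  · simp only [hE₂, eq₂_lhs_eq (hu _)]
    refine ((((hd _ _).fun_mul (hd _ _)).fun_mul (hd _ _)).fun_mul (hd _ _)).mul_of_eq_zero ?_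
      (hsolution.slope_eq₂ n m)
    unfold slopeQuad
    refine (((hd n (m+2)).fun_mul ((((hs n m).fun_mul (hs (n+1) m)).fun_mul
      (hs n (m+1))).fun_mul (hs (n+1) (m+1)))).fun_add ((hd (n+2) m).fun_mul
        ((((((hs n (m+1)).fun_mul (hs (n+1) (m+1))).fun_add ((hs n m).fun_mul
          (hs (n+1) m))).fun_add ((hs n m).fun_mul (hs (n+1) (m+1)))).fun_sub
            (hs n m)).fun_sub (hs (n+1) (m+1))))).congr_deriv ?_
    have h1 := hsolution.slope_eq₂ n m
    have h2 := hsolution.slopeQuad_rate n m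
    simp only [slopeQuad] at h1 h2
    linear_combination (flowRate (u t₀) n (m+2) + slopeRate (u t₀) n m + slopeRate (u t₀) (n+1) m
      + slopeRate (u t₀) n (m+1) + slopeRate (u t₀) (n+1) (m+1)) * h1 + u t₀ (n+2) m * h2
  · simp only [hE₃, eq₃_lhs_eq (hu _)]
    refine (((hd _ _).fun_mul (hd _ _)).fun_mul (hd _ _)).mul_of_eq_zero ?_
      (hsolution.slope_eq₃ n m)
    refine (((hd n (m+1)).fun_mul (((hs n m).fun_mul (hs (n+1) m)).fun_mul
      (hs (n+2) m))).fun_add (hd (n+3) m)).congr_deriv ?_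
    have h1 := hsolution.slope_eq₃ n m
    have h2 := flowRate_add_slopeRate (u t₀) n m
    linear_combination flowRate (u t₀) (n+3) m * h1 + u t₀ n (m+1) * (latticeSlope (u t₀) n m
      * latticeSlope (u t₀) (n+1) m * latticeSlope (u t₀) (n+2) m) * h2
end
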